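/- For every integer k ≥ 2, every α ∈ Δ', and every ε > 0, there exists β ∈ Δ' with ‖β − α‖ < ε such that Φ(β) < Φ(α) in the reverse lexicographic order on ℕ^ℕ. -/

import Mathlib

open Filter Topology
open scoped Classical

namespace BetaDF

/-- Digit sequences (elements of `Σ = {0,…,k−1}^ℕ` when all entries are `< k`). -/
abbrev Seq : Type := ℕ → ℕ

/-- Lexicographic (strict) order on digit sequences. -/
def seqLt (v w : Seq) : Prop := ∃ r, (∀ s, s < r → v s = w s) ∧ v r < w r

/-- Lexicographic order on digit sequences. -/
def seqLe (v w : Seq) : Prop := seqLt v w ∨ v = w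

/-- The shift map `σ`. -/
def shift (w : Seq) : Seq := fun r => w (r + 1)

/-- Membership in `Σ = {0,…,k−1}^ℕ`. -/
def InSigma (k : ℕ) (w : Seq) : Prop := ∀ r, w r < k

/-- A sequence is maximal if it is `≥` every element of its shift orbit. -/
def IsMaximal (w : Seq) : Prop := ∀ r, seqLe (shift^[r] w) w

/-- Number of occurrences of the digit `i` among the first `r` entries of `w`. -/
def digitCount (w : Seq) (i r : ℕ) : ℕ := ((Finset.range r).filter fun s => w s = i).card

/-- The ambient Euclidean space `ℝ^k`. -/
abbrev E (k : ℕ) : Type := EuclideanSpace ℝ (Fin k)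

/-- The `i`-th coordinate (with junk value `0` for `i ≥ k`). -/
def proj {k : ℕ} (α : E k) (i : ℕ) : ℝ := if h : i < k then α ⟨i, h⟩ else 0

/-- `w` has digit frequency vector `α`. -/
def HasDigitFreq (k : ℕ) (w : Seq) (α : E k) : Prop :=
  ∀ i, i < k →
    Tendsto (fun r => (digitCount w i r : ℝ) / (r : ℝ)) atTop (𝓝 (proj α i))

/-- The standard `(k−1)`-simplex `Δ`. -/
def simplex (k : ℕ) : Set (E k) := {α | (∀ i : Fin k, 0 ≤ α i) ∧ ∑ i, α i = 1}

/-- The face `F = {α ∈ Δ : α_{k−1} = 0}`. -/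
def faceF (k : ℕ) : Set (E k) := {α ∈ simplex k | proj α (k - 1) = 0}

/-- `Δ' = Δ ∖ F`. -/
def simplex' (k : ℕ) : Set (E k) := simplex k \ faceF k

/-- `J(α) = ⌊α₀/α_{k−1}⌋`. -/
noncomputable def Jfun {k : ℕ} (α : E k) : ℕ := ⌊proj α 0 / proj α (k - 1)⌋₊

/-- The map `K_n`. -/
noncomputable def Kmap {k : ℕ} (n : ℕ) (α : E k) : E k :=
  (WithLp.equiv 2 (Fin k → ℝ)).symm fun i =>
    if (i : ℕ) + 2 < k then proj α ((i : ℕ) + 1) / (1 - proj α 0)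
    else if (i : ℕ) + 2 = k then (proj α 0 - n * proj α (k - 1)) / (1 - proj α 0)
    else ((n + 1) * proj α (k - 1) - proj α 0) / (1 - proj α 0)

/-- The continued-fraction map `K : Δ' → Δ'`, `K(α) = K_{J(α)}(α)`. -/
noncomputable def Kstep {k : ℕ} (α : E k) : E k := Kmap (Jfun α) α

/-- The itinerary map `Φ(α)_r = J(K^r(α))`. -/
noncomputable def Phi {k : ℕ} (α : E k) : ℕ → ℕ := fun r => Jfun (Kstep^[r] α)

/-- The projective embedding `K_n^{-1} : Δ → Δ`. -/
noncomputable def Kinv {k : ℕ} (n : ℕ) (α : E k) : E k :=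
  (WithLp.equiv 2 (Fin k → ℝ)).symm fun i =>
    (if (i : ℕ) = 0 then (n + 1) * proj α (k - 2) + n * proj α (k - 1)
      else if (i : ℕ) + 1 = k then proj α (k - 2) + proj α (k - 1)
      else proj α ((i : ℕ) - 1)) /
      ((n + 1) * proj α (k - 2) + n * proj α (k - 1) + 1)

/-- `Υ_{n,r} = K_{n₀}^{-1} ∘ ⋯ ∘ K_{n_r}^{-1}`. -/
noncomputable def Ups {k : ℕ} (n : ℕ → ℕ) : ℕ → E k → E k
  | 0 => Kinv (n 0)
  | r + 1 => fun α => Ups n r (Kinv (n (r + 1)) α)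

/-- `A_{n,r} = Υ_{n,r}(Δ)`. -/
noncomputable def Anr (k : ℕ) (n : ℕ → ℕ) (r : ℕ) : Set (E k) := Ups n r '' simplex k

/-- `F_{n,r} = Υ_{n,r}(F)`. -/
noncomputable def Fnr (k : ℕ) (n : ℕ → ℕ) (r : ℕ) : Set (E k) := Ups n r '' faceF k

/-- Reverse-lexicographic strict order on `ℕ^ℕ`: `a < b` iff `a` exceeds `b`
at the first index where they differ. -/
def revLexLt (a b : ℕ → ℕ) : Prop := ∃ r, (∀ s, s < r → a s = b s) ∧ b r < a r

/-- The word to which the substitution `Λ_n` sends the digit `i`. -/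
def lamWord (k n i : ℕ) : List ℕ :=
  if i + 2 < k then [i + 1]
  else if i + 2 = k then (k - 1) :: List.replicate (n + 1) 0
  else (k - 1) :: List.replicate n 0

/-- The substitution `Λ_n : Σ → Σ`. -/
def lamSub (k n : ℕ) (w : Seq) : Seq := fun m =>
  (((List.range (m + 1)).map fun r => lamWord k n (w r)).flatten).getD m 0

/-- `Λ_{n,r} = Λ_{n₀} ∘ ⋯ ∘ Λ_{n_r}`. -/
def lamChain (k : ℕ) (n : ℕ → ℕ) : ℕ → Seq → Seq
  | 0 => lamSub k (n 0)
  | r + 1 => fun w => lamChain k n r (lamSub k (n (r + 1)) w)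

/-- `Λ_{n₀} ∘ ⋯ ∘ Λ_{n_{R−1}}` for a finite list of indices. -/
def lamList (k : ℕ) : List ℕ → Seq → Seq
  | [], w => w
  | a :: t, w => lamSub k a (lamList k t w)

/-- The constant sequence `(k−1)(k−1)(k−1)…`. -/
def topSeq (k : ℕ) : Seq := fun _ => k - 1

/-- The sequence `(k−1)000…`. -/
def baseSeq (k : ℕ) : Seq := fun m => if m = 0 then k - 1 else 0

/-- `S(n) = lim_{r→∞} Λ_{n,r}((k−1)(k−1)(k−1)…)` (limit in the product topology). -/
noncomputable def Sseq (k : ℕ) (n : ℕ → ℕ) : Seq :=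
  limUnder atTop fun r => lamChain k n r (topSeq k)

/-- The compactified itinerary space `N`: sequences with values in `ℕ∞` such that
all entries from the first `∞` onwards equal `∞`.  Elements with no `∞` entry
correspond to `ℕ^ℕ`; the others are the finite type elements `n₀…n_{R−1}∞`. -/
def NN : Type := {m : ℕ → ℕ∞ // ∀ r, m r = ⊤ → m (r + 1) = ⊤}

/-- Reverse-lexicographic strict order on `N` (`∞` counts as larger than every natural). -/
def nnLt (m n : NN) : Prop := ∃ r, (∀ s, s < r → m.1 s = n.1 s) ∧ n.1 r < m.1 r

/-- Reverse-lexicographic order on `N`. -/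
def nnLe (m n : NN) : Prop := nnLt m n ∨ m = n

/-- The element of `N` determined by an element of `ℕ^ℕ`. -/
def toNN (g : ℕ → ℕ) : NN := ⟨fun r => (g r : ℕ∞), fun r h => absurd h (by simp)⟩

/-- The itinerary `n₀ … n_{R−1} (n_R + 1) 0 0 0 …` (of rational type). -/
def ratSeq (f : ℕ → ℕ) (R : ℕ) : ℕ → ℕ := fun r =>
  if r < R then f r else if r = R then f R + 1 else 0

/-- The finite type element `n₀ … n_{R−1} n_R ∞` of `N`. -/
def finNN (f : ℕ → ℕ) (R : ℕ) : NN :=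
  ⟨fun r => if r ≤ R then (f r : ℕ∞) else ⊤, by
    intro r h
    show (if r + 1 ≤ R then ((f (r + 1) : ℕ∞)) else ⊤) = ⊤
    have h' : (if r ≤ R then ((f r : ℕ∞)) else ⊤) = ⊤ := h
    by_cases h1 : r ≤ R
    · rw [if_pos h1] at h'
      exact absurd h' (by simp)
    · rw [if_neg (by omega : ¬ r + 1 ≤ R)]⟩

/-- The extension of `S` to `N`. -/
noncomputable def SN (k : ℕ) (m : NN) : Seq :=
  if h : ∃ R, m.1 R = ⊤ then
    lamList k ((List.range (Nat.find h)).map fun r => (m.1 r).toNat) (baseSeq k)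
  else Sseq k fun r => (m.1 r).toNat

/-- The metric `d(m,n) = 2^{−X(m,n)}` on `N`, where
`X(m,n) = r + min(m₀+⋯+m_r, n₀+⋯+n_r)` and `r` is the first index where `m,n` differ. -/
noncomputable def dN (m n : NN) : ℝ :=
  if h : m = n then 0
  else
    have hex : ∃ r, m.1 r ≠ n.1 r := by
      by_contra hc
      push_neg at hc
      exact h (Subtype.ext (funext hc))
    (2 : ℝ) ^ (-(((Nat.find hex : ℕ) : ℤ) +
      ((min (∑ s ∈ Finset.range (Nat.find hex + 1), m.1 s)
            (∑ s ∈ Finset.range (Nat.find hex + 1), n.1 s)).toNat : ℤ)))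

/-- The symbolic β-shift `X(w)`. -/
def Xset (k : ℕ) (w : Seq) : Set Seq :=
  {v | InSigma k v ∧ ∀ r, seqLe (shift^[r] v) w}

/-- The digit frequency set `DF(w)` of the symbolic β-shift `X(w)`. -/
def DFw (k : ℕ) (w : Seq) : Set (E k) :=
  {α | α ∈ simplex k ∧ ∃ v ∈ Xset k w, HasDigitFreq k v α}

/-- `DF(n) = DF(S(n))` for `n ∈ ℕ^ℕ`. -/
noncomputable def DFn (k : ℕ) (n : ℕ → ℕ) : Set (E k) := DFw k (Sseq k n)

/-- `DF(n) = DF(S(n))` for `n ∈ N`. -/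
noncomputable def DFN (k : ℕ) (m : NN) : Set (E k) := DFw k (SN k m)

/-- The infimax map `I = S ∘ Φ` on `Δ'`, extended by `I(α) = (k−1)000…` on `F`. -/
noncomputable def Ifun (k : ℕ) (α : E k) : Seq :=
  if α ∈ simplex' k then Sseq k (Phi α) else baseSeq k

/-- The simplex `T_m = {α ∈ Δ : (m+1)α_{k−1} ≤ α₀}`. -/
def Tset (k m : ℕ) : Set (E k) :=
  {α ∈ simplex k | ((m : ℝ) + 1) * proj α (k - 1) ≤ proj α 0}

/-- The standard basis vector `e_i`. -/
noncomputable def evec (k i : ℕ) : E k :=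
  (WithLp.equiv 2 (Fin k → ℝ)).symm fun j => if (j : ℕ) = i then 1 else 0

/-- The rational extreme points
`FE(n) = {Υ_{n,s}(e_{k−2}) : n_{s+t} ≠ 0 for some 1 ≤ t ≤ k−2}`. -/
noncomputable def FEset (k : ℕ) (n : ℕ → ℕ) : Set (E k) :=
  {α | ∃ s, (∃ t, 1 ≤ t ∧ t ≤ k - 2 ∧ n (s + t) ≠ 0) ∧ α = Ups n s (evec k (k - 2))}

/-- The set `E(n)` of non-trivial extreme points of `DF(n)`:
extreme points other than `e₀,…,e_{k−2}`. -/
noncomputable def Eset (k : ℕ) (n : ℕ → ℕ) : Set (E k) :=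
  Set.extremePoints ℝ (DFn k n) \ {α | ∃ i, i ≤ k - 2 ∧ α = evec k i}

/-- The fiber `Φ^{-1}(n) ⊆ Δ'`. -/
noncomputable def PhiFiber (k : ℕ) (n : ℕ → ℕ) : Set (E k) :=
  {α ∈ simplex' k | Phi α = n}

/-- `f_β(x) = βx mod 1`. -/
noncomputable def fbeta (β x : ℝ) : ℝ := Int.fract (β * x)

/-- The digit sequence of the greedy β-expansion of `x`: `d_β(x)_r = ⌊β f_β^r(x)⌋`. -/
noncomputable def dbeta (β : ℝ) (x : ℝ) : Seq := fun r => ⌊β * (fbeta β)^[r] x⌋₊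

/-- The digit frequency set `DF(β)` of β-expansions of points of `[0,1]`. -/
noncomputable def DFbeta (k : ℕ) (β : ℝ) : Set (E k) :=
  {α | α ∈ simplex k ∧ ∃ x ∈ Set.Icc (0 : ℝ) 1, HasDigitFreq k (dbeta β x) α}

/-- The sequence `w_β`: if `d_β(1) = d₁…d_{r−1}d_r000…` with `d_r > 0` then `w_β`
is the infinite repetition of `d₁…d_{r−1}(d_r − 1)`; otherwise `w_β = d_β(1)`. -/
noncomputable def wbeta (β : ℝ) : Seq :=
  if h : ∃ r, dbeta β 1 r ≠ 0 ∧ ∀ s, r < s → dbeta β 1 s = 0 then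
    fun m =>
      if m % (Nat.find h + 1) = Nat.find h then dbeta β 1 (Nat.find h) - 1
      else dbeta β 1 (m % (Nat.find h + 1))
  else dbeta β 1

/-- `DF` extended to `[k−1,k]` by `DF(k−1) = F` and `DF(k) = Δ`. -/
noncomputable def DFext (k : ℕ) (β : ℝ) : Set (E k) :=
  if β ≤ (k : ℝ) - 1 then faceF k
  else if (k : ℝ) ≤ β then simplex k
  else DFbeta k β

/-- The mode-locking interval `I_{n₀…n_R}` determined by the word `f 0, …, f R`. -/
noncomputable def Iint (k : ℕ) (f : ℕ → ℕ) (R : ℕ) : Set ℝ :=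
  {β | (k : ℝ) - 1 < β ∧ β < k ∧
    seqLe (Sseq k (ratSeq f R)) (wbeta β) ∧ seqLe (wbeta β) (SN k (finNN f R))}

/-- The frequency vector of the first `s` digits of `w`. -/
noncomputable def freqVec (k : ℕ) (w : Seq) (s : ℕ) : E k :=
  (WithLp.equiv 2 (Fin k → ℝ)).symm fun i => (digitCount w (i : ℕ) s : ℝ) / (s : ℝ)


/-- The linear lift of `Kmap n`. -/
noncomputable def Lin (k n : ℕ) (x : ℕ → ℝ) : ℕ → ℝ := fun i =>
  if i + 2 < k then x (i + 1)
  else if i + 2 = k then x 0 - n * x (k - 1)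
  else if i + 1 = k then (n + 1) * x (k - 1) - x 0
  else 0

/-- Iterated linear lifts along the itinerary `n`. -/
noncomputable def Xit (k : ℕ) (n : ℕ → ℕ) (x : ℕ → ℝ) : ℕ → ℕ → ℝ
  | 0 => x
  | r + 1 => Lin k (n r) (Xit k n x r)

lemma proj_of_lt {k : ℕ} (α : E k) (i : ℕ) (h : i < k) : proj α i = α ⟨i, h⟩ := by
  simp [proj, h]

lemma proj_nonneg {k : ℕ} {α : E k} (h : α ∈ simplex' k) (i : ℕ) : 0 ≤ proj α i := by
  unfold proj
  split_ifs with hi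
  · exact h.1.1 _
  · exact le_rfl

lemma proj_last_pos {k : ℕ} {α : E k} (h : α ∈ simplex' k) : 0 < proj α (k - 1) :=
  lt_of_le_of_ne (proj_nonneg h _) (fun h0 => h.2 ⟨h.1, h0.symm⟩)

lemma one_sub_pos {k : ℕ} (hk : 2 ≤ k) {α : E k} (h : α ∈ simplex' k) : 0 < 1 - proj α 0 := by
  obtain ⟨m, rfl⟩ : ∃ m, k = m + 2 := ⟨k - 2, by omega⟩
  have hl := proj_last_pos h
  have hs := h.1.2
  rw [Fin.sum_univ_succ, Fin.sum_univ_castSucc] at hs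
  have h1 : 0 ≤ ∑ i : Fin m, α (Fin.castSucc i).succ := Finset.sum_nonneg (fun i _ => h.1.1 _)
  have e1 : proj α (m + 2 - 1) = α (Fin.last m).succ := by
    rw [proj_of_lt _ _ (by omega)]; rfl
  have e0 : proj α 0 = α 0 := by
    rw [proj_of_lt _ _ (by omega)]; rfl
  rw [e1] at hl
  rw [e0]
  linarith

lemma J_bounds {k : ℕ} {α : E k} (h : α ∈ simplex' k) :
    0 ≤ proj α 0 - Jfun α * proj α (k - 1) ∧ 0 < (Jfun α + 1) * proj α (k - 1) - proj α 0 := by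
  have hl := proj_last_pos h
  have h0 := proj_nonneg h 0
  have h1 : (Jfun α : ℝ) ≤ proj α 0 / proj α (k - 1) := Nat.floor_le (by positivity)
  have h2 : proj α 0 / proj α (k - 1) < (Jfun α : ℝ) + 1 := Nat.lt_floor_add_one _
  rw [le_div_iff₀ hl] at h1
  rw [div_lt_iff₀ hl] at h2
  constructor <;> linarith

lemma proj_Kstep {k : ℕ} (α : E k) (i : ℕ) :
    proj (Kstep α) i = Lin k (Jfun α) (proj α) i / (1 - proj α 0) := by
  unfold Lin
  by_cases hi : i < k
  · rw [proj_of_lt _ _ hi]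
    simp only [Kstep, Kmap, WithLp.equiv_symm_apply]
    split_ifs <;> first | rfl | omega
  · simp only [proj, hi, dif_neg, not_false_eq_true]
    rw [if_neg (by omega), if_neg (by omega), if_neg (by omega)]
    simp

lemma Kstep_mem {k : ℕ} (hk : 2 ≤ k) {α : E k} (h : α ∈ simplex' k) : Kstep α ∈ simplex' k := by
  have hp := one_sub_pos hk h
  obtain ⟨hb1, hb2⟩ := J_bounds h
  refine ⟨⟨fun i => ?_, ?_⟩, fun hF => ?_⟩
  · have := proj_Kstep α i
    rw [proj_of_lt _ _ i.2] at this
    change Kstep α i = _ at this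
    rw [this]
    refine div_nonneg ?_ hp.le
    unfold Lin
    split_ifs
    · exact proj_nonneg h _
    · exact hb1
    · exact hb2.le
    · exact le_rfl
  · have hs := h.1.2
    have e : ∀ i : Fin k, Kstep α i = Lin k (Jfun α) (proj α) i / (1 - proj α 0) := by
      intro i
      rw [← proj_Kstep, proj_of_lt _ _ i.2]
    have e' : ∀ i : Fin k, α i = proj α i := by
      intro i
      rw [proj_of_lt _ _ i.2]
    rw [Finset.sum_congr rfl (fun i _ => e i), ← Finset.sum_div, div_eq_one_iff_eq hp.ne']
    rw [Finset.sum_congr rfl (fun i _ => e' i), Fin.sum_univ_eq_sum_range (fun i => proj α i)] at hs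
    rw [Fin.sum_univ_eq_sum_range (fun i => Lin k (Jfun α) (proj α) i)]
    obtain ⟨m, rfl⟩ : ∃ m, k = m + 2 := ⟨k - 2, by omega⟩
    rw [Finset.sum_range_succ, Finset.sum_range_succ']  at hs
    rw [Finset.sum_range_succ, Finset.sum_range_succ]
    have e1 : ∑ i ∈ Finset.range m, Lin (m + 2) (Jfun α) (proj α) i
        = ∑ i ∈ Finset.range m, proj α (i + 1) := by
      refine Finset.sum_congr rfl (fun i hi => ?_)
      have := Finset.mem_range.1 hi
      unfold Lin
      rw [if_pos (by omega)]
    rw [e1]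
    simp [Lin]
    linarith
  · have := hF.2
    rw [proj_Kstep, div_eq_zero_iff] at this
    rcases this with h1 | h1
    · unfold Lin at h1
      rw [if_neg (by omega), if_neg (by omega), if_pos (by omega)] at h1
      linarith
    · linarith

lemma Lin_smul (k n : ℕ) (c : ℝ) (x : ℕ → ℝ) (i : ℕ) :
    Lin k n (fun i => c * x i) i = c * Lin k n x i := by
  unfold Lin
  split_ifs <;> ring

lemma Xit_add (k : ℕ) (n : ℕ → ℕ) (c : ℝ) (x v : ℕ → ℝ) (r : ℕ) :
    ∀ i, Xit k n (fun i => x i + c * v i) r i = Xit k n x r i + c * Xit k n v r i := by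
  induction r with
  | zero => intro i; rfl
  | succ r ih =>
    intro i
    have : Xit k n (fun i => x i + c * v i) r = fun i => Xit k n x r i + c * Xit k n v r i :=
      funext ih
    simp only [Xit, this]
    unfold Lin
    split_ifs <;> ring

lemma iter_lift {k : ℕ} (hk : 2 ≤ k) {α : E k} (h : α ∈ simplex' k) (n : ℕ → ℕ) (x : ℕ → ℝ)
    (c : ℝ) (hc : 0 < c) (hx : ∀ i, proj α i = c * x i) (r : ℕ) (hr : ∀ s, s < r → Phi α s = n s) :
    Kstep^[r] α ∈ simplex' k ∧ ∃ c > 0, ∀ i, proj (Kstep^[r] α) i = c * Xit k n x r i := by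
  induction r with
  | zero => exact ⟨h, c, hc, hx⟩
  | succ r ih =>
    obtain ⟨hm, c', hc', he⟩ := ih (fun s hs => hr s (by omega))
    rw [Function.iterate_succ_apply']
    have hp := one_sub_pos hk hm
    refine ⟨Kstep_mem hk hm, c' / (1 - proj (Kstep^[r] α) 0), by positivity, fun i => ?_⟩
    have hn : Jfun (Kstep^[r] α) = n r := hr r (by omega)
    rw [proj_Kstep, hn]
    have : proj (Kstep^[r] α) = fun i => c' * Xit k n x r i := funext he
    conv_lhs => rw [show Lin k (n r) (proj (Kstep^[r] α)) i = c' * Lin k (n r) (Xit k n x r) i by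
      rw [this, Lin_smul]]
    simp only [Xit]
    ring

/-- The starting direction `e₀`. -/
noncomputable def dir0 : ℕ → ℝ := fun i => if i = 0 then 1 else 0

lemma cone (k : ℕ) (hk : 2 ≤ k) (n : ℕ → ℕ) (r : ℕ) :
    (∀ i, i + 1 < k → 0 ≤ Xit k n dir0 r i) ∧ Xit k n dir0 r (k - 1) ≤ 0 := by
  induction r with
  | zero =>
    refine ⟨fun i _ => ?_, ?_⟩
    · simp only [Xit, dir0]; split_ifs <;> norm_num
    · simp only [Xit, dir0]; rw [if_neg (by omega)]
  | succ r ih =>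
    obtain ⟨h1, h2⟩ := ih
    have h0 := h1 0 (by omega)
    have hn : (0 : ℝ) ≤ n r := Nat.cast_nonneg _
    refine ⟨fun i hi => ?_, ?_⟩
    · simp only [Xit]
      unfold Lin
      split_ifs
      · exact h1 _ (by omega)
      · nlinarith
      · omega
      · exact le_rfl
    · simp only [Xit]
      unfold Lin
      rw [if_neg (by omega), if_neg (by omega), if_pos (by omega)]
      nlinarith

lemma shift0 (k : ℕ) (n : ℕ → ℕ) (x : ℕ → ℝ) (r j : ℕ) (hj : j + 1 < k) :
    Xit k n x (r + j) 0 = Xit k n x r j := by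
  induction j generalizing r with
  | zero => rfl
  | succ j ih =>
    rw [show r + (j + 1) = (r + 1) + j by omega, ih (r + 1) (by omega)]
    simp only [Xit]
    unfold Lin
    rw [if_pos (by omega)]

lemma return0 (k : ℕ) (hk : 2 ≤ k) (n : ℕ → ℕ) (r : ℕ) :
    Xit k n dir0 r 0 ≤ Xit k n dir0 (r + (k - 1)) 0 := by
  rw [show r + (k - 1) = (r + 1) + (k - 2) by omega, shift0 k n _ _ _ (by omega)]
  simp only [Xit]
  unfold Lin
  rw [if_neg (by omega), if_pos (by omega)]
  have := (cone k hk n r).2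
  have hn : (0 : ℝ) ≤ n r := Nat.cast_nonneg _
  nlinarith

lemma return0' (k : ℕ) (hk : 2 ≤ k) (n : ℕ → ℕ) (q : ℕ) :
    1 ≤ Xit k n dir0 (q * (k - 1)) 0 := by
  induction q with
  | zero => simp [Xit, dir0]
  | succ q ih =>
    rw [Nat.succ_mul]
    exact ih.trans (return0 k hk n _)

lemma dstep (k : ℕ) (hk : 2 ≤ k) (n : ℕ → ℕ) (r : ℕ) :
    Xit k n dir0 (r + 1) (k - 1) ≤ Xit k n dir0 r (k - 1) - Xit k n dir0 r 0 := by
  simp only [Xit]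
  conv_lhs => unfold Lin
  rw [if_neg (by omega), if_neg (by omega), if_pos (by omega)]
  have := (cone k hk n r).2
  have hn : (0 : ℝ) ≤ n r := Nat.cast_nonneg _
  nlinarith

lemma danti (k : ℕ) (hk : 2 ≤ k) (n : ℕ → ℕ) : Antitone fun r => Xit k n dir0 r (k - 1) :=
  antitone_nat_of_succ_le fun r => by
    have := dstep k hk n r
    have := (cone k hk n r).1 0 (by omega)
    linarith

lemma dgrow (k : ℕ) (hk : 2 ≤ k) (n : ℕ → ℕ) (q : ℕ) :
    Xit k n dir0 (q * (k - 1)) (k - 1) ≤ - q := by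
  induction q with
  | zero => simpa using (cone k hk n 0).2
  | succ q ih =>
    have h1 : Xit k n dir0 ((q + 1) * (k - 1)) (k - 1) ≤ Xit k n dir0 (q * (k - 1) + 1) (k - 1) :=
      danti k hk n (by rw [Nat.succ_mul]; omega)
    have h2 := dstep k hk n (q * (k - 1))
    have h3 := return0' k hk n q
    push_cast
    linarith

lemma key {k : ℕ} (hk : 2 ≤ k) {α β : E k} (hα : α ∈ simplex' k) (hβ : β ∈ simplex' k)
    (δ c : ℝ) (hδ : 0 < δ) (hc : 0 < c) (h : ∀ i, proj β i = c * (proj α i + δ * dir0 i)) :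
    revLexLt (Phi β) (Phi α) := by
  have hA : ∀ r, _ := fun r =>
    iter_lift hk hα (Phi α) (proj α) 1 one_pos (fun i => (one_mul _).symm) r (fun _ _ => rfl)
  have hB : ∀ r, (∀ s, s < r → Phi β s = Phi α s) → _ := fun r hr =>
    iter_lift hk hβ (Phi α) (fun i => proj α i + δ * dir0 i) c hc h r hr
  by_cases heq : ∃ r, Phi β r ≠ Phi α r
  · refine ⟨Nat.find heq, fun s hs => not_not.1 (Nat.find_min heq hs), ?_⟩
    have hne := Nat.find_spec heq
    have hr : ∀ s, s < Nat.find heq → Phi β s = Phi α s :=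
      fun s hs => not_not.1 (Nat.find_min heq hs)
    generalize Nat.find heq = r at hne hr
    obtain ⟨ma, ca, hca, ea⟩ := hA r
    obtain ⟨mb, cb, hcb, eb⟩ := hB r hr
    refine lt_of_le_of_ne ?_ hne.symm
    unfold Phi Jfun
    apply Nat.floor_le_floor
    have pa := proj_last_pos ma
    have pb := proj_last_pos mb
    have na := proj_nonneg ma 0
    rw [ea] at pa na
    rw [eb, Xit_add] at pb
    rw [ea, ea, eb, eb, mul_div_mul_left _ _ hca.ne', mul_div_mul_left _ _ hcb.ne',
      Xit_add, Xit_add]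
    have pb' := pos_of_mul_pos_right pb hcb.le
    have na' := nonneg_of_mul_nonneg_right na hca
    obtain ⟨c1, c2⟩ := cone k hk (Phi α) r
    have c0 := c1 0 (by omega)
    apply div_le_div₀ <;> nlinarith
  · push Not at heq
    exfalso
    have hpos : ∀ r, 0 < Xit k (Phi α) (proj α) r (k - 1)
        + δ * Xit k (Phi α) dir0 r (k - 1) := by
      intro r
      obtain ⟨mb, cb, hcb, eb⟩ := hB r (fun s _ => heq s)
      have pb := proj_last_pos mb
      rw [eb, Xit_add] at pb
      exact pos_of_mul_pos_right pb hcb.le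
    have hanti : Antitone fun r => Xit k (Phi α) (proj α) r (k - 1) := by
      refine antitone_nat_of_succ_le fun r => ?_
      obtain ⟨ma, ca, hca, ea⟩ := hA (r + 1)
      have n1 := proj_nonneg ma (k - 2)
      rw [ea] at n1
      have n2 := nonneg_of_mul_nonneg_right n1 hca
      simp only [Xit] at n2 ⊢
      unfold Lin at n2
      rw [if_neg (by omega), if_pos (by omega)] at n2
      conv_lhs => unfold Lin
      rw [if_neg (by omega), if_neg (by omega), if_pos (by omega)]
      linarith
    obtain ⟨q, hq⟩ := exists_nat_gt (proj α (k - 1) / δ)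
    have h1 := hpos (q * (k - 1))
    have h2 : Xit k (Phi α) (proj α) (q * (k - 1)) (k - 1) ≤ proj α (k - 1) :=
      hanti (Nat.zero_le _)
    have h3 := dgrow k hk (Phi α) q
    rw [div_lt_iff₀ hδ] at hq
    nlinarith

/-- the itinerary map has no local minima. -/
theorem stmt1 (k : ℕ) (hk : 2 ≤ k) (α : E k) (hα : α ∈ simplex' k) (ε : ℝ) (hε : 0 < ε) :
    ∃ β ∈ simplex' k, dist β α < ε ∧ revLexLt (Phi β) (Phi α) := by
  let f : ℝ → E k := fun δ => (1 + δ)⁻¹ • (α + δ • evec k 0)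
  have hf : ContinuousAt f 0 := by
    have : ContinuousAt (fun δ : ℝ => (1 + δ)⁻¹) 0 :=
      ContinuousAt.inv₀ (by fun_prop) (by norm_num)
    exact this.smul (by fun_prop)
  have hf0 : f 0 = α := by simp [f]
  obtain ⟨η, hη, hd⟩ := Metric.continuousAt_iff.1 hf ε hε
  have hδ : 0 < η / 2 := by linarith
  have hdist : dist (f (η / 2)) α < ε := by
    rw [← hf0]
    apply hd
    rw [Real.dist_eq, sub_zero, abs_of_pos hδ]
    linarith
  generalize η / 2 = δ at hδ hdist
  have h1 : 0 < (1 + δ)⁻¹ := by positivity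
  have hc : ∀ i : Fin k, f δ i = (1 + δ)⁻¹ * (α i + δ * dir0 i) := by
    intro i
    simp [f, evec, dir0]
    split_ifs <;> ring
  have hp : ∀ i, proj (f δ) i = (1 + δ)⁻¹ * (proj α i + δ * dir0 i) := by
    intro i
    by_cases hi : i < k
    · rw [proj_of_lt _ _ hi, proj_of_lt _ _ hi, hc]
    · simp only [proj, hi, dif_neg, not_false_eq_true, dir0]
      rw [if_neg (by omega)]; simp
  have hβ : f δ ∈ simplex' k := by
    refine ⟨⟨fun i => ?_, ?_⟩, fun hF => ?_⟩
    · rw [hc]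
      have := hα.1.1 i
      have : 0 ≤ dir0 i := by unfold dir0; split_ifs <;> norm_num
      positivity
    · rw [Finset.sum_congr rfl (fun i _ => hc i), ← Finset.mul_sum, Finset.sum_add_distrib,
        hα.1.2, ← Finset.mul_sum, Fin.sum_univ_eq_sum_range (fun i => dir0 i)]
      have : ∑ i ∈ Finset.range k, dir0 i = 1 := by
        unfold dir0
        rw [Finset.sum_ite_eq' , if_pos (Finset.mem_range.2 (by omega))]
      rw [this, mul_one]
      exact inv_mul_cancel₀ (by positivity)
    · have h2 := hF.2
      rw [hp] at h2
      have h3 := proj_last_pos hα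
      have : dir0 (k - 1) = 0 := by unfold dir0; rw [if_neg (by omega)]
      rw [this] at h2
      simp only [mul_zero, add_zero] at h2
      have := mul_pos h1 h3
      linarith
  exact ⟨f δ, hβ, hdist, key hk hα hβ δ _ hδ h1 hp⟩

end BetaDF
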